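/- arXiv:2108.11911 — 2 statements merged into one kernel-verified Lean document; each statement's English description precedes it below -/
import Mathlib

section
/- Suppose the input maps X^in(i,j), 1 ≤ i < j ≤ n, are generated according to the random corruption model, and suppose the dimension d = d(n) satisfies d(n)⁴ log(n)/n → 0 as n → ∞ (i.e., d ∈ o((n/log n)^{1/4})). If p_true > 0.585, then the probability that the ground truth X̄ (with X̄(i,j) = I_d for all 1 ≤ i < j ≤ n) is the unique optimal solution of the basic LP (P) tends to 1 as n → ∞. -/
open Matrix
open scoped Classical

noncomputable section

/-- The permutation matrix of a permutation `σ` of `Fin d`. -/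
def permMat (d : ℕ) (σ : Equiv.Perm (Fin d)) : Matrix (Fin d) (Fin d) ℝ :=
  Matrix.of fun t q => if σ q = t then 1 else 0

/-- The objective function of the basic LP (P):
`∑_{i<j} ∑_{t,q} a_{tq}(i,j) X_{tq}(i,j)`. -/
def lpObj (n d : ℕ) (a X : Fin n → Fin n → Matrix (Fin d) (Fin d) ℝ) : ℝ :=
  ∑ p ∈ Finset.univ.filter (fun p : Fin n × Fin n => p.1 < p.2),
    ∑ t : Fin d, ∑ q : Fin d, a p.1 p.2 t q * X p.1 p.2 t q

/-- The feasible region of the basic LP (P): all row and column sums equal one,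
the triangle inequalities hold, and all entries are nonnegative. -/
def lpFeasible (n d : ℕ) (X : Fin n → Fin n → Matrix (Fin d) (Fin d) ℝ) : Prop :=
  (∀ i j : Fin n, i < j → ∀ t : Fin d, ∑ q : Fin d, X i j t q = 1) ∧
  (∀ i j : Fin n, i < j → ∀ q : Fin d, ∑ t : Fin d, X i j t q = 1) ∧
  (∀ i j k : Fin n, i < j → j < k → ∀ l t q : Fin d,
      X i j l t + X j k t q - X i k l q ≤ 1 ∧
      X i j l t - X j k t q + X i k l q ≤ 1 ∧
      - X i j l t + X j k t q + X i k l q ≤ 1) ∧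
  (∀ i j : Fin n, i < j → ∀ t q : Fin d, 0 ≤ X i j t q)

/-- The quantity `δ_{t→q}^{i→j}` of the dual certificate. -/
def deltaJOM (n d : ℕ) (a : Fin n → Fin n → Matrix (Fin d) (Fin d) ℝ) (α β : ℝ)
    (i j : Fin n) (t q : Fin d) : ℝ :=
  (1 / (n : ℝ)) *
    ∑ k ∈ Finset.univ.filter (fun k : Fin n => k ≠ i ∧ k ≠ j ∧ a k i t t = -1),
      ((a k j t q - a i j t q) / α + (a i j t t - a k j t t) / (β * d))

/-- The quantity `κ_t(i,j)` of the dual certificate. -/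
def kappaJOM (n d : ℕ) (a : Fin n → Fin n → Matrix (Fin d) (Fin d) ℝ) (α β : ℝ)
    (i j : Fin n) (t : Fin d) : ℝ :=
  (1 / (n : ℝ)) *
      ∑ l ∈ Finset.univ.filter (fun l : Fin d => l ≠ t),
        ∑ k ∈ Finset.univ.filter (fun k : Fin n => k ≠ i ∧ k ≠ j),
          min (a k i l t / α + a k j t t / (β * d)) (a k j l t / α + a k i t t / (β * d))
    + (1 / (n : ℝ)) * (1 / (2 * α) - ((d : ℝ) - 1) / (2 * β * d)) *
        ((∑ k ∈ Finset.univ.filter (fun k : Fin n => k ≠ i), a k i t t) +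
          ∑ k ∈ Finset.univ.filter (fun k : Fin n => k ≠ j), a k j t t)
    - ((d : ℝ) - 2) / α + 1
    + (1 / (2 * (n : ℝ))) *
        ∑ l ∈ Finset.univ.filter (fun l : Fin d => l ≠ t),
          ((a i j t l + a j i t l) / α + 2 * a i j t t / (β * d))

/-- A sample of the random corruption model: for each (ordered) pair of objects, a
Bernoulli coin and a uniformly random permutation. -/
abbrev Sample (n d : ℕ) := Fin n → Fin n → Bool × Equiv.Perm (Fin d)

/-- The probability weight of a sample: each coin is heads with probability `p`, each
permutation is uniform among the `d!` permutations, all independently. -/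
def wtJOM (n d : ℕ) (p : ℝ) (ω : Sample n d) : ℝ :=
  ∏ i : Fin n, ∏ j : Fin n,
    ((if (ω i j).1 then p else 1 - p) / (Nat.factorial d : ℝ))

/-- The probability of an event under the random corruption model. -/
def prJOM (n d : ℕ) (p : ℝ) (E : Sample n d → Prop) : ℝ :=
  ∑ ω : Sample n d, if E ω then wtJOM n d p ω else 0

/-- The random input map for a pair `i < j`: the identity (ground truth) if the coin
shows heads, and an independent uniformly random permutation matrix otherwise. -/
def baseMat (n d : ℕ) (ω : Sample n d) (i j : Fin n) : Matrix (Fin d) (Fin d) ℝ :=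
  if (ω i j).1 then 1 else permMat d (ω i j).2

/-- The full collection of random input maps, extended by transposition:
`X^in(j,i) = X^in(i,j)ᵀ`. -/
def XinRand (n d : ℕ) (ω : Sample n d) (i j : Fin n) : Matrix (Fin d) (Fin d) ℝ :=
  if i < j then baseMat n d ω i j else if j < i then (baseMat n d ω j i)ᵀ else 1

/-- The random coefficients `a_{tq}(i,j) = 1 - 2 X^in_{tq}(i,j)`. -/
def aRand (n d : ℕ) (ω : Sample n d) (i j : Fin n) : Matrix (Fin d) (Fin d) ℝ :=
  Matrix.of fun t q => 1 - 2 * XinRand n d ω i j t q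


/-! ### Deterministic part -/

/-- Symmetric extension of a solution. -/
def extJ (n d : ℕ) (Y : Fin n → Fin n → Matrix (Fin d) (Fin d) ℝ) (i j : Fin n) :
    Matrix (Fin d) (Fin d) ℝ :=
  if i < j then Y i j else if j < i then (Y j i)ᵀ else 1

lemma extJ_symm (n d : ℕ) (Y : Fin n → Fin n → Matrix (Fin d) (Fin d) ℝ) (i j : Fin n)
    (t q : Fin d) : extJ n d Y j i q t = extJ n d Y i j t q := by
  unfold extJ
  rcases lt_trichotomy i j with h | h | h
  · simp [h, h.not_gt]
  · subst h; simp [Matrix.one_apply, eq_comm]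
  · simp [h, h.not_gt]

lemma extJ_nonneg {n d : ℕ} {Y : Fin n → Fin n → Matrix (Fin d) (Fin d) ℝ}
    (hY : lpFeasible n d Y) (i j : Fin n) (t q : Fin d) : 0 ≤ extJ n d Y i j t q := by
  obtain ⟨h1, h2, h3, h4⟩ := hY
  unfold extJ
  rcases lt_trichotomy i j with h | h | h
  · simp [h, h4 i j h t q]
  · subst h; simp only [lt_self_iff_false, if_false, Matrix.one_apply]; split_ifs <;> norm_num
  · simp [h, h.not_gt, h4 j i h q t]

lemma extJ_row {n d : ℕ} {Y : Fin n → Fin n → Matrix (Fin d) (Fin d) ℝ}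
    (hY : lpFeasible n d Y) (i j : Fin n) (t : Fin d) : ∑ q, extJ n d Y i j t q = 1 := by
  obtain ⟨h1, h2, h3, h4⟩ := hY
  unfold extJ
  rcases lt_trichotomy i j with h | h | h
  · simp [h, h1 i j h t]
  · subst h; simp [Matrix.one_apply]
  · simp [h, h.not_gt, h2 j i h t]

lemma extJ_col {n d : ℕ} {Y : Fin n → Fin n → Matrix (Fin d) (Fin d) ℝ}
    (hY : lpFeasible n d Y) (i j : Fin n) (q : Fin d) : ∑ t, extJ n d Y i j t q = 1 := by
  rw [← extJ_row hY j i q]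
  exact Finset.sum_congr rfl fun t _ => (extJ_symm n d Y i j t q).symm

lemma extJ_le_one {n d : ℕ} {Y : Fin n → Fin n → Matrix (Fin d) (Fin d) ℝ}
    (hY : lpFeasible n d Y) (i j : Fin n) (t q : Fin d) : extJ n d Y i j t q ≤ 1 := by
  rw [← extJ_row hY i j t]
  exact Finset.single_le_sum (f := fun q => extJ n d Y i j t q)
    (fun q _ => extJ_nonneg hY i j t q) (Finset.mem_univ q)

lemma extJ_tri {n d : ℕ} {Y : Fin n → Fin n → Matrix (Fin d) (Fin d) ℝ}
    (hY : lpFeasible n d Y) (i k j : Fin n) (l t q : Fin d) :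
    extJ n d Y i k l t + extJ n d Y k j t q - extJ n d Y i j l q ≤ 1 := by
  have hn := extJ_nonneg hY
  have ho := extJ_le_one hY
  by_cases hik : i = k
  · subst hik
    have e : extJ n d Y i i l t = if l = t then 1 else 0 := by simp [extJ, Matrix.one_apply]
    rw [e]
    split_ifs with h
    · subst h; linarith
    · linarith [hn i j l q, ho i j t q]
  by_cases hkj : k = j
  · subst hkj
    have e : extJ n d Y k k t q = if t = q then 1 else 0 := by simp [extJ, Matrix.one_apply]
    rw [e]
    split_ifs with h
    · subst h; linarith
    · linarith [hn i k l q, ho i k l t]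
  by_cases hij : i = j
  · subst hij
    have e : extJ n d Y i i l q = if l = q then 1 else 0 := by simp [extJ, Matrix.one_apply]
    rw [e, ← extJ_symm n d Y k i t q]
    split_ifs with h
    · subst h; linarith [ho i k l t]
    · have : ∑ x ∈ ({l, q} : Finset (Fin d)), extJ n d Y i k x t ≤ ∑ x, extJ n d Y i k x t :=
        Finset.sum_le_sum_of_subset_of_nonneg (Finset.subset_univ _) (fun x _ _ => hn i k x t)
      rw [extJ_col hY, Finset.sum_pair h] at this
      linarith
  obtain ⟨h1, h2, h3, h4⟩ := hY
  unfold extJ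
  rcases lt_or_gt_of_ne hik with a | a <;> rcases lt_or_gt_of_ne hkj with b | b <;>
    rcases lt_or_gt_of_ne hij with c | c
  all_goals simp only [a, b, c, a.not_gt, b.not_gt, c.not_gt, if_true, if_false,
    Matrix.transpose_apply]
  · linarith [(h3 i k j a b l t q).1]
  · exact absurd (a.trans b) c.not_gt
  · linarith [(h3 i j k c b l q t).2.2]
  · linarith [(h3 j i k c a q l t).2.2]
  · linarith [(h3 k i j a c t l q).2.1]
  · linarith [(h3 k j i b c t q l).2.1]
  · exact absurd (b.trans a) c.not_gt
  · linarith [(h3 j k i b a q t l).1]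

lemma sum_off {d : ℕ} (f : Fin d → ℝ) (t : Fin d) :
    ∑ q, (if q = t then 0 else f q) = (∑ q, f q) - f t := by
  have : ∀ q, (if q = t then 0 else f q) = f q - (if q = t then f q else 0) := by
    intro q; split_ifs <;> simp
  simp_rw [this, Finset.sum_sub_distrib]
  simp

/-- The key deterministic inequality. `A` plays the role of the input maps, `Z` of a feasible
solution. -/
lemma key_det {n d : ℕ} (hd : 2 ≤ d)
    (A Z : Fin n → Fin n → Matrix (Fin d) (Fin d) ℝ)
    (As : ∀ i j t q, A j i q t = A i j t q)
    (A0 : ∀ i j t q, 0 ≤ A i j t q)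
    (Ar : ∀ i j t, ∑ q, A i j t q = 1)
    (Zs : ∀ i j t q, Z j i q t = Z i j t q)
    (Z0 : ∀ i j t q, 0 ≤ Z i j t q)
    (Zr : ∀ i j t, ∑ q, Z i j t q = 1)
    (Zt : ∀ i k j l t q, Z i k l t + Z k j t q - Z i j l q ≤ 1)
    (hL : ∀ i t q, t ≠ q → ∑ j, A i j t q ≤ 0.415 * n / d) :
    (∀ i j t, Z i j t t = 1) ∨
      ∑ i, ∑ j, ∑ t, ∑ q, (if q = t then 0 else A i j t q * Z i j t q) <
        ∑ i, ∑ j, ∑ t, A i j t t * (1 - Z i j t t) := by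
  have hdR : (2 : ℝ) ≤ d := by exact_mod_cast hd
  rcases Nat.eq_zero_or_pos n with hn0 | hnpos
  · subst hn0; left; intro i; exact i.elim0
  have hnR : (0 : ℝ) < n := by exact_mod_cast hnpos
  set L : ℝ := 0.415 * n / d with hLdef
  set b : ℝ := (d - 1) * L with hb
  set g : Fin n → Fin n → Fin d → ℝ := fun i j t => A i j t t with hg
  set u : Fin n → Fin n → Fin d → ℝ := fun i j t => 1 - Z i j t t with hu
  have L0 : 0 ≤ L := by positivity
  have b0 : 0 ≤ b := mul_nonneg (by linarith) L0
  have g0 : ∀ i j t, 0 ≤ g i j t := fun i j t => A0 i j t t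
  have g1 : ∀ i j t, 0 ≤ 1 - g i j t := by
    intro i j t
    have := Finset.single_le_sum (f := fun q => A i j t q) (fun q _ => A0 i j t q)
      (Finset.mem_univ t)
    rw [Ar] at this
    simp only [hg]; linarith
  have u0 : ∀ i j t, 0 ≤ u i j t := by
    intro i j t
    have := Finset.single_le_sum (f := fun q => Z i j t q) (fun q _ => Z0 i j t q)
      (Finset.mem_univ t)
    rw [Zr] at this
    simp only [hu]; linarith
  have gs : ∀ i j t, g j i t = g i j t := fun i j t => As i j t t
  have us : ∀ i j t, u j i t = u i j t := fun i j t => by simp only [hu]; rw [Zs]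
  have offA : ∀ i j t, ∑ q, (if q = t then 0 else A i j t q) = 1 - g i j t := by
    intro i j t; rw [sum_off, Ar]
  have offZ : ∀ i j t, ∑ q, (if q = t then 0 else Z i j t q) = u i j t := by
    intro i j t; rw [sum_off, Zr]
  have hbad : ∀ i t, ∑ j, (1 - g i j t) ≤ b := by
    intro i t
    simp_rw [← offA]
    rw [Finset.sum_comm]
    calc ∑ q, ∑ j, (if q = t then 0 else A i j t q)
        ≤ ∑ q, (if q = t then 0 else L) := by
          apply Finset.sum_le_sum; intro q _
          split_ifs with h
          · simp
          · exact hL i t q (Ne.symm h)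
      _ = b := by rw [sum_off]; simp [hb]; ring
  have hgood : ∀ i t, n - b ≤ ∑ j, g i j t := by
    intro i t
    have := hbad i t
    rw [Finset.sum_sub_distrib] at this
    simp at this; linarith
  have hcom : ∀ i j t, n - 2 * b ≤ ∑ k, g i k t * g k j t := by
    intro i j t
    calc (n : ℝ) - 2 * b ≤ ∑ k, (g i k t + g j k t - 1) := by
          rw [Finset.sum_sub_distrib, Finset.sum_add_distrib]
          simp only [Finset.sum_const, Finset.card_univ, Fintype.card_fin, nsmul_eq_mul, mul_one]
          linarith [hgood i t, hgood j t]
      _ ≤ _ := by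
          apply Finset.sum_le_sum; intro k _
          rw [gs k j t]
          nlinarith [mul_nonneg (g1 i k t) (g1 k j t)]
  set B : Fin d → ℝ := fun t => ∑ i, ∑ j, g i j t * u i j t with hB
  set S : Fin d → ℝ := fun t => ∑ i, ∑ j, (1 - g i j t) * u i j t with hS
  set D : Fin d → ℝ := fun t => ∑ i, ∑ j, ∑ q, (if q = t then 0 else A i j t q * Z i j t q)
    with hD
  have B0 : ∀ t, 0 ≤ B t := fun t => Finset.sum_nonneg fun i _ => Finset.sum_nonneg fun j _ =>
    mul_nonneg (g0 i j t) (u0 i j t)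
  have S0 : ∀ t, 0 ≤ S t := fun t => Finset.sum_nonneg fun i _ => Finset.sum_nonneg fun j _ =>
    mul_nonneg (g1 i j t) (u0 i j t)
  -- charging the good entries
  have hcharge : ∀ t, ∑ i, ∑ j, ∑ k, (1 - g i j t) * (g i k t * u i k t) ≤ b * B t := by
    intro t
    rw [hB, Finset.mul_sum]
    apply Finset.sum_le_sum; intro i _
    rw [← Finset.sum_mul_sum]
    exact mul_le_mul_of_nonneg_right (hbad i t)
      (Finset.sum_nonneg fun j _ => mul_nonneg (g0 i j t) (u0 i j t))
  have hSB : ∀ t, (n - 2 * b) * S t ≤ 2 * b * B t := by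
    intro t
    have h2 : ∑ i, ∑ j, ∑ k, (1 - g i j t) * (g k j t * u k j t)
        = ∑ i, ∑ j, ∑ k, (1 - g i j t) * (g i k t * u i k t) := by
      rw [Finset.sum_comm]
      apply Finset.sum_congr rfl; intro i _
      apply Finset.sum_congr rfl; intro j _
      apply Finset.sum_congr rfl; intro k _
      rw [gs i j t, gs i k t, us i k t]
    calc (n - 2 * b) * S t = ∑ i, ∑ j, (1 - g i j t) * u i j t * (n - 2 * b) := by
          simp_rw [hS, Finset.mul_sum]
          apply Finset.sum_congr rfl; intro i _
          apply Finset.sum_congr rfl; intro j _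
          ring
      _ ≤ ∑ i, ∑ j, ∑ k, ((1 - g i j t) * (g i k t * u i k t)
            + (1 - g i j t) * (g k j t * u k j t)) := by
          apply Finset.sum_le_sum; intro i _
          apply Finset.sum_le_sum; intro j _
          refine (mul_le_mul_of_nonneg_left (hcom i j t)
            (mul_nonneg (g1 i j t) (u0 i j t))).trans ?_
          rw [Finset.mul_sum]
          apply Finset.sum_le_sum; intro k _
          have ht : u i j t ≤ u i k t + u k j t := by
            have := Zt i k j t t t
            simp only [hu]; linarith
          have e1 : g i k t * g k j t * u i j t ≤ g i k t * u i k t + g k j t * u k j t := by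
            have s1 := mul_le_mul_of_nonneg_left ht (mul_nonneg (g0 i k t) (g0 k j t))
            have s2 := mul_nonneg (mul_nonneg (g0 i k t) (u0 i k t)) (g1 k j t)
            have s3 := mul_nonneg (mul_nonneg (g0 k j t) (u0 k j t)) (g1 i k t)
            nlinarith
          have := mul_le_mul_of_nonneg_left e1 (g1 i j t)
          nlinarith
      _ ≤ 2 * b * B t := by
          simp_rw [Finset.sum_add_distrib]
          rw [h2]
          linarith [hcharge t]
  have hDB : ∀ t, (n - b) * D t ≤ b * B t + L * (B t + S t) := by
    intro t
    calc (n - b) * D t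
        = ∑ i, ∑ j, ∑ q, (if q = t then 0 else A i j t q * Z i j t q) * (n - b) := by
          simp_rw [hD, Finset.mul_sum]
          apply Finset.sum_congr rfl; intro i _
          apply Finset.sum_congr rfl; intro j _
          apply Finset.sum_congr rfl; intro q _
          ring
      _ ≤ ∑ i, ∑ j, ∑ q, ∑ k, ((if q = t then 0 else A i j t q) * (g i k t * u i k t)
            + (if q = t then 0 else A i j t q * Z k j t q)) := by
          apply Finset.sum_le_sum; intro i _
          apply Finset.sum_le_sum; intro j _
          apply Finset.sum_le_sum; intro q _
          split_ifs with hq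
          · simp
          refine (mul_le_mul_of_nonneg_left (hgood i t)
            (mul_nonneg (A0 i j t q) (Z0 i j t q))).trans ?_
          rw [Finset.mul_sum]
          apply Finset.sum_le_sum; intro k _
          have ht : Z i j t q ≤ u i k t + Z k j t q := by
            have := Zt k i j t t q
            rw [Zs i k t t] at this
            simp only [hu]; linarith
          have e1 : g i k t * Z i j t q ≤ g i k t * u i k t + Z k j t q := by
            have s1 := mul_le_mul_of_nonneg_left ht (g0 i k t)
            have s2 := mul_nonneg (g1 i k t) (Z0 k j t q)
            nlinarith
          have := mul_le_mul_of_nonneg_left e1 (A0 i j t q)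
          nlinarith
      _ = ∑ i, ∑ j, ∑ k, (1 - g i j t) * (g i k t * u i k t)
          + ∑ k, ∑ j, ∑ q, (if q = t then 0 else Z k j t q) * ∑ i, A j i q t := by
          simp_rw [Finset.sum_add_distrib]
          congr 1
          · apply Finset.sum_congr rfl; intro i _
            apply Finset.sum_congr rfl; intro j _
            rw [← Finset.sum_mul_sum, offA, Finset.mul_sum]
          · calc ∑ i, ∑ j, ∑ q, ∑ k, (if q = t then 0 else A i j t q * Z k j t q)
                = ∑ i, ∑ j, ∑ k, ∑ q, (if q = t then 0 else A i j t q * Z k j t q) := by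
                  apply Finset.sum_congr rfl; intro i _
                  apply Finset.sum_congr rfl; intro j _
                  rw [Finset.sum_comm]
              _ = ∑ i, ∑ k, ∑ j, ∑ q, (if q = t then 0 else A i j t q * Z k j t q) := by
                  apply Finset.sum_congr rfl; intro i _
                  rw [Finset.sum_comm]
              _ = ∑ k, ∑ i, ∑ j, ∑ q, (if q = t then 0 else A i j t q * Z k j t q) := by
                  rw [Finset.sum_comm]
              _ = _ := by
                  apply Finset.sum_congr rfl; intro k _
                  rw [Finset.sum_comm]
                  apply Finset.sum_congr rfl; intro j _
                  rw [Finset.sum_comm]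
                  apply Finset.sum_congr rfl; intro q _
                  rw [Finset.mul_sum]
                  apply Finset.sum_congr rfl; intro i _
                  rw [As i j t q]
                  split_ifs <;> ring
      _ ≤ b * B t + L * (B t + S t) := by
          apply add_le_add (hcharge t)
          have : L * (B t + S t) = ∑ k, ∑ j, ∑ q, (if q = t then 0 else Z k j t q) * L := by
            simp_rw [hB, hS, ← Finset.sum_add_distrib, Finset.mul_sum, ← Finset.sum_mul, offZ]
            simp_rw [Finset.sum_mul]
            apply Finset.sum_congr rfl; intro k _
            apply Finset.sum_congr rfl; intro j _
            ring
          rw [this]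
          apply Finset.sum_le_sum; intro k _
          apply Finset.sum_le_sum; intro j _
          apply Finset.sum_le_sum; intro q _
          split_ifs with hq
          · simp
          · exact mul_le_mul_of_nonneg_left (hL j q t hq) (Z0 k j t q)
  -- numerics
  obtain ⟨x, hx⟩ : ∃ x : ℝ, x = 1 / d := ⟨_, rfl⟩
  have x0 : 0 < x := by rw [hx]; positivity
  have hLx : L = 0.415 * n * x := by rw [hLdef, hx]; ring
  have hbx : b = 0.415 * n * (1 - x) := by
    rw [hb, hLdef, hx]; field_simp
  have hC : 0 < n - 2 * b := by rw [hbx]; nlinarith [mul_pos hnR x0]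
  have hG : 0 < n - b := by linarith
  have hnum : (n - 2 * b) * b + L * (n - 2 * b) + 2 * L * b < (n - 2 * b) * (n - b) := by
    have : (n - 2 * b) * (n - b) - ((n - 2 * b) * b + L * (n - 2 * b) + 2 * L * b)
        = n ^ 2 * (0.0289 - 0.1328 * x + 0.6889 * x ^ 2) := by
      rw [hbx, hLx]; ring
    have h2 : 0 < (0.0289 - 0.1328 * x + 0.6889 * x ^ 2) := by nlinarith [sq_nonneg (x - 0.0964)]
    have := mul_pos (pow_pos hnR 2) h2
    linarith
  have SB : (n - 2 * b) * ∑ t, S t ≤ 2 * b * ∑ t, B t := by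
    rw [Finset.mul_sum, Finset.mul_sum]; exact Finset.sum_le_sum fun t _ => hSB t
  have DB : (n - b) * ∑ t, D t ≤ b * ∑ t, B t + L * (∑ t, B t + ∑ t, S t) := by
    rw [← Finset.sum_add_distrib, Finset.mul_sum, Finset.mul_sum, Finset.mul_sum,
      ← Finset.sum_add_distrib]
    exact Finset.sum_le_sum fun t _ => hDB t
  have BB0 : 0 ≤ ∑ t, B t := Finset.sum_nonneg fun t _ => B0 t
  have SS0 : 0 ≤ ∑ t, S t := Finset.sum_nonneg fun t _ => S0 t
  rcases BB0.eq_or_lt with hz | hpos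
  · left
    rw [← hz] at SB
    have hS0 : ∑ t, S t = 0 := le_antisymm (by nlinarith) SS0
    have hsum : ∑ t, ∑ i, ∑ j, u i j t = 0 := by
      have : ∑ t, ∑ i, ∑ j, u i j t = ∑ t, B t + ∑ t, S t := by
        simp_rw [hB, hS, ← Finset.sum_add_distrib]
        apply Finset.sum_congr rfl; intro t _
        apply Finset.sum_congr rfl; intro i _
        apply Finset.sum_congr rfl; intro j _
        ring
      rw [this, hS0, ← hz]; ring
    intro i j t
    have h1 := (Finset.sum_eq_zero_iff_of_nonneg (fun t _ => Finset.sum_nonneg fun i _ =>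
      Finset.sum_nonneg fun j _ => u0 i j t)).1 hsum t (Finset.mem_univ t)
    have h2 := (Finset.sum_eq_zero_iff_of_nonneg (fun i _ =>
      Finset.sum_nonneg fun j _ => u0 i j t)).1 h1 i (Finset.mem_univ i)
    have h3 := (Finset.sum_eq_zero_iff_of_nonneg (fun j _ => u0 i j t)).1 h2 j (Finset.mem_univ j)
    simp only [hu] at h3; linarith
  · right
    have eD : ∑ i, ∑ j, ∑ t, ∑ q, (if q = t then 0 else A i j t q * Z i j t q) = ∑ t, D t := by
      simp only [hD]
      conv_rhs => rw [Finset.sum_comm]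
      apply Finset.sum_congr rfl; intro i _
      conv_rhs => rw [Finset.sum_comm]
    have eB : ∑ i, ∑ j, ∑ t, A i j t t * (1 - Z i j t t) = ∑ t, B t := by
      simp only [hB]
      conv_rhs => rw [Finset.sum_comm]
      apply Finset.sum_congr rfl; intro i _
      conv_rhs => rw [Finset.sum_comm]
    rw [eD, eB]
    have k1 := mul_le_mul_of_nonneg_left DB hC.le
    have k2 := mul_le_mul_of_nonneg_left SB L0
    have k3 := mul_lt_mul_of_pos_right hnum hpos
    have k4 : ((n - 2 * b) * (n - b)) * ∑ t, D t < ((n - 2 * b) * (n - b)) * ∑ t, B t := by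
      nlinarith
    exact lt_of_mul_lt_mul_left k4 (mul_pos hC hG).le

lemma sum_pairs_symm {n : ℕ} (f : Fin n → Fin n → ℝ) (hs : ∀ i j, f j i = f i j)
    (h0 : ∀ i, f i i = 0) :
    ∑ i, ∑ j, f i j =
      2 * ∑ p ∈ Finset.univ.filter (fun p : Fin n × Fin n => p.1 < p.2), f p.1 p.2 := by
  rw [Finset.sum_filter, Fintype.sum_prod_type]
  have e : ∀ i j, f i j = (if i < j then f i j else 0) + (if j < i then f j i else 0) := by
    intro i j
    rcases lt_trichotomy i j with h | h | h
    · simp [h, h.not_gt]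
    · subst h; simp [h0]
    · simp [h, h.not_gt, hs]
  calc ∑ i, ∑ j, f i j = ∑ i, ∑ j, ((if i < j then f i j else 0) + (if j < i then f j i else 0)) :=
        Finset.sum_congr rfl fun i _ => Finset.sum_congr rfl fun j _ => e i j
    _ = _ := by
        simp_rw [Finset.sum_add_distrib]
        rw [Finset.sum_comm (f := fun i j => if j < i then f j i else 0)]
        ring

lemma XinRand_eq (n d : ℕ) (ω : Sample n d) : XinRand n d ω = extJ n d (baseMat n d ω) := rfl

lemma baseMat_nonneg (n d : ℕ) (ω : Sample n d) (i j : Fin n) (t q : Fin d) :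
    0 ≤ baseMat n d ω i j t q := by
  unfold baseMat permMat
  split_ifs
  · rw [Matrix.one_apply]; split_ifs <;> norm_num
  · simp only [Matrix.of_apply]; split_ifs <;> norm_num

lemma baseMat_row (n d : ℕ) (ω : Sample n d) (i j : Fin n) (t : Fin d) :
    ∑ q, baseMat n d ω i j t q = 1 := by
  unfold baseMat permMat
  split_ifs
  · simp [Matrix.one_apply]
  · simp [← Equiv.eq_symm_apply]

lemma baseMat_col (n d : ℕ) (ω : Sample n d) (i j : Fin n) (q : Fin d) :
    ∑ t, baseMat n d ω i j t q = 1 := by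
  unfold baseMat permMat
  split_ifs
  · simp [Matrix.one_apply]
  · simp

lemma XinRand_nonneg (n d : ℕ) (ω : Sample n d) (i j : Fin n) (t q : Fin d) :
    0 ≤ XinRand n d ω i j t q := by
  unfold XinRand
  split_ifs
  · exact baseMat_nonneg ..
  · exact baseMat_nonneg ..
  · rw [Matrix.one_apply]; split_ifs <;> norm_num

lemma XinRand_row (n d : ℕ) (ω : Sample n d) (i j : Fin n) (t : Fin d) :
    ∑ q, XinRand n d ω i j t q = 1 := by
  unfold XinRand
  split_ifs
  · exact baseMat_row ..
  · exact baseMat_col ..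
  · simp [Matrix.one_apply]

lemma feasible_one (n d : ℕ) : lpFeasible n d (fun _ _ => 1) := by
  refine ⟨?_, ?_, ?_, ?_⟩
  · intro i j _ t; simp [Matrix.one_apply]
  · intro i j _ t; simp [Matrix.one_apply]
  · intro i j k _ _ l t q
    simp only [Matrix.one_apply]
    refine ⟨?_, ?_, ?_⟩ <;> split_ifs <;> first | (exfalso; grind) | norm_num
  · intro i j _ t q; simp only [Matrix.one_apply]; split_ifs <;> norm_num

lemma det_recovery {n d : ℕ} (hd : 2 ≤ d) (ω : Sample n d)
    (hL : ∀ i t q, t ≠ q → ∑ j, XinRand n d ω i j t q ≤ 0.415 * n / d)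
    (Y : Fin n → Fin n → Matrix (Fin d) (Fin d) ℝ) (hY : lpFeasible n d Y) :
    (∀ i j : Fin n, i < j → Y i j = 1) ∨
      lpObj n d (aRand n d ω) (fun _ _ => 1) < lpObj n d (aRand n d ω) Y := by
  have key := key_det hd (XinRand n d ω) (extJ n d Y)
    (by rw [XinRand_eq]; exact extJ_symm n d _) (XinRand_nonneg n d ω) (XinRand_row n d ω)
    (extJ_symm n d Y) (extJ_nonneg hY) (extJ_row hY) (extJ_tri hY) hL
  rcases key with h | h
  · left
    intro i j hij
    have hrow := extJ_row hY i j
    have hn := extJ_nonneg hY i j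
    have e : extJ n d Y i j = Y i j := by simp [extJ, hij]
    have h := h i j
    rw [e] at hrow hn h
    ext t q
    rw [Matrix.one_apply]
    split_ifs with htq
    · subst htq; exact h t
    · have : ∑ x ∈ ({t, q} : Finset (Fin d)), Y i j t x ≤ ∑ x, Y i j t x :=
        Finset.sum_le_sum_of_subset_of_nonneg (Finset.subset_univ _) (fun x _ _ => hn t x)
      rw [hrow, Finset.sum_pair htq, h] at this
      linarith [hn t q]
  · right
    set f : Fin n → Fin n → ℝ := fun i j =>
      ∑ t, ∑ q, aRand n d ω i j t q * (extJ n d Y i j t q - (1 : Matrix (Fin d) (Fin d) ℝ) t q)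
      with hf
    have hfs : ∀ i j, f j i = f i j := by
      intro i j
      simp only [hf]
      rw [Finset.sum_comm]
      apply Finset.sum_congr rfl; intro t _
      apply Finset.sum_congr rfl; intro q _
      rw [extJ_symm n d Y i j t q]
      simp only [aRand, Matrix.of_apply, XinRand_eq, Matrix.one_apply]
      rw [extJ_symm n d _ i j t q]
      simp only [eq_comm]
    have hf0 : ∀ i, f i i = 0 := by
      intro i; simp [hf, extJ]
    have e1 := sum_pairs_symm f hfs hf0
    have e2 : ∑ p ∈ Finset.univ.filter (fun p : Fin n × Fin n => p.1 < p.2), f p.1 p.2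
        = lpObj n d (aRand n d ω) Y - lpObj n d (aRand n d ω) (fun _ _ => 1) := by
      unfold lpObj
      rw [← Finset.sum_sub_distrib]
      apply Finset.sum_congr rfl; intro p hp
      have hpl : p.1 < p.2 := (Finset.mem_filter.1 hp).2
      simp only [hf, extJ, hpl, if_true]
      simp_rw [← Finset.sum_sub_distrib, mul_sub]
    have e3 : ∀ i j, f i j = 2 * (∑ t, XinRand n d ω i j t t * (1 - extJ n d Y i j t t)
        - ∑ t, ∑ q, (if q = t then 0 else XinRand n d ω i j t q * extJ n d Y i j t q)) := by
      intro i j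
      simp only [hf]
      rw [← Finset.sum_sub_distrib, Finset.mul_sum]
      apply Finset.sum_congr rfl; intro t _
      have r := extJ_row hY i j t
      have w : ∀ q, aRand n d ω i j t q *
          (extJ n d Y i j t q - (1 : Matrix (Fin d) (Fin d) ℝ) t q)
          = extJ n d Y i j t q - (if t = q then 1 else 0)
            - 2 * (XinRand n d ω i j t q * extJ n d Y i j t q)
            + 2 * (if t = q then XinRand n d ω i j t q else 0) := by
        intro q
        simp only [aRand, Matrix.of_apply, Matrix.one_apply]
        split_ifs <;> ring
      simp_rw [w]
      rw [Finset.sum_add_distrib, Finset.sum_sub_distrib, Finset.sum_sub_distrib, r, sum_off,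
        ← Finset.mul_sum, ← Finset.mul_sum]
      simp
      ring
    have e4 : ∑ i, ∑ j, f i j = 2 * (∑ i, ∑ j, ∑ t, XinRand n d ω i j t t * (1 - extJ n d Y i j t t)
        - ∑ i, ∑ j, ∑ t, ∑ q,
          (if q = t then 0 else XinRand n d ω i j t q * extJ n d Y i j t q)) := by
      simp_rw [e3, ← Finset.mul_sum, Finset.sum_sub_distrib]
    linarith

/-! ### Probabilistic part -/

/-- One-site weight. -/
def siteW (d : ℕ) (p : ℝ) (s : Bool × Equiv.Perm (Fin d)) : ℝ :=
  (if s.1 then p else 1 - p) / (Nat.factorial d : ℝ)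

/-- One-site matrix. -/
def siteM (d : ℕ) (s : Bool × Equiv.Perm (Fin d)) : Matrix (Fin d) (Fin d) ℝ :=
  if s.1 then 1 else permMat d s.2

lemma siteW_nonneg (d : ℕ) {p : ℝ} (hp0 : 0 ≤ p) (hp1 : p ≤ 1)
    (s : Bool × Equiv.Perm (Fin d)) : 0 ≤ siteW d p s := by
  unfold siteW
  split_ifs
  · positivity
  · exact div_nonneg (by linarith) (by positivity)

lemma siteW_sum (d : ℕ) (p : ℝ) : ∑ s, siteW d p s = 1 := by
  unfold siteW
  rw [Fintype.sum_prod_type]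
  have : (d.factorial : ℝ) ≠ 0 := by positivity
  simp [Fintype.card_perm]
  field_simp
  ring

lemma perm_count (d : ℕ) (hd : 0 < d) (t q : Fin d) :
    ∑ σ : Equiv.Perm (Fin d), (if σ q = t then (1 : ℝ) else 0) = d.factorial / d := by
  have hinv : ∀ tt : Fin d, ∑ σ : Equiv.Perm (Fin d), (if σ q = tt then (1 : ℝ) else 0)
      = ∑ σ : Equiv.Perm (Fin d), (if σ q = t then (1 : ℝ) else 0) := by
    intro tt
    refine Fintype.sum_equiv (Equiv.mulLeft (Equiv.swap t tt)) _ _ ?_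
    intro σ
    simp only [Equiv.coe_mulLeft, Equiv.Perm.mul_apply]
    have : (Equiv.swap t tt) (σ q) = t ↔ σ q = tt := by
      rw [Equiv.swap_apply_eq_iff, Equiv.swap_apply_left]
    simp [this]
  have htot : ∑ tt : Fin d, ∑ σ : Equiv.Perm (Fin d), (if σ q = tt then (1 : ℝ) else 0)
      = d.factorial := by
    rw [Finset.sum_comm]
    simp [Fintype.card_perm]
  simp_rw [hinv] at htot
  simp only [Finset.sum_const, Finset.card_univ, Fintype.card_fin, nsmul_eq_mul] at htot
  have : (d : ℝ) ≠ 0 := by positivity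
  field_simp
  linarith

lemma site_mgf (d : ℕ) (hd : 0 < d) (p lam : ℝ) {t q : Fin d} (htq : t ≠ q) :
    ∑ s, siteW d p s * Real.exp (lam * siteM d s t q)
      ≤ Real.exp ((1 - p) / d * (Real.exp lam - 1)) := by
  have h1 : ∀ s, siteW d p s * Real.exp (lam * siteM d s t q)
      = siteW d p s + (Real.exp lam - 1) * (siteW d p s * siteM d s t q) := by
    intro s
    have : siteM d s t q = 0 ∨ siteM d s t q = 1 := by
      unfold siteM permMat
      split_ifs
      · simp [htq]
      · simp only [Matrix.of_apply]; split_ifs <;> simp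
    rcases this with h | h <;> rw [h] <;> simp
    ring
  simp_rw [h1]
  rw [Finset.sum_add_distrib, siteW_sum, ← Finset.mul_sum]
  have h2 : ∑ s, siteW d p s * siteM d s t q = (1 - p) / d := by
    rw [Fintype.sum_prod_type]
    simp only [Fintype.sum_bool, siteW, siteM, permMat]
    simp only [if_true, Matrix.one_apply_ne htq, mul_zero, Finset.sum_const_zero, zero_add,
      Bool.false_eq_true, if_false, Matrix.of_apply]
    rw [← Finset.mul_sum, perm_count d hd]
    have : (d.factorial : ℝ) ≠ 0 := by positivity
    field_simp
  rw [h2]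
  have := Real.add_one_le_exp ((1 - p) / d * (Real.exp lam - 1))
  linarith

lemma sample_sum_prod (n d : ℕ) (f : Fin n → Fin n → Bool × Equiv.Perm (Fin d) → ℝ) :
    ∑ ω : Sample n d, ∏ i, ∏ j, f i j (ω i j) = ∏ i, ∏ j, ∑ s, f i j s := by
  rw [← Fintype.prod_sum (fun i (r : Fin n → Bool × Equiv.Perm (Fin d)) => ∏ j, f i j (r j))]
  exact Finset.prod_congr rfl fun i _ => (Fintype.prod_sum (f i)).symm

lemma wt_eq (n d : ℕ) (p : ℝ) (ω : Sample n d) :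
    wtJOM n d p ω = ∏ i, ∏ j, siteW d p (ω i j) := rfl

lemma wt_nonneg (n d : ℕ) {p : ℝ} (hp0 : 0 ≤ p) (hp1 : p ≤ 1) (ω : Sample n d) :
    0 ≤ wtJOM n d p ω := by
  rw [wt_eq]
  exact Finset.prod_nonneg fun i _ => Finset.prod_nonneg fun j _ => siteW_nonneg d hp0 hp1 _

lemma wt_sum (n d : ℕ) (p : ℝ) : ∑ ω, wtJOM n d p ω = 1 := by
  simp_rw [wt_eq]
  rw [sample_sum_prod n d (fun _ _ => siteW d p)]
  simp [siteW_sum]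

/-- Contribution of the coordinate `(a,b)` to the count at `(v,t,q)`. -/
def contr (n d : ℕ) (v : Fin n) (t q : Fin d) (a b : Fin n) (s : Bool × Equiv.Perm (Fin d)) : ℝ :=
  (if a = v then (if v < b then siteM d s t q else 0) else 0) +
    (if b = v then (if a < v then siteM d s q t else 0) else 0)

lemma count_eq (n d : ℕ) (ω : Sample n d) (v : Fin n) {t q : Fin d} (htq : t ≠ q) :
    ∑ j, XinRand n d ω v j t q = ∑ a, ∑ b, contr n d v t q a b (ω a b) := by
  unfold contr
  simp_rw [Finset.sum_add_distrib]
  rw [Finset.sum_comm (f := fun a b => if a = v then (if v < b then siteM d (ω a b) t q else 0)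
    else 0)]
  simp only [Finset.sum_ite_eq', Finset.mem_univ, if_true]
  rw [← Finset.sum_add_distrib]
  apply Finset.sum_congr rfl; intro j _
  unfold XinRand
  rcases lt_trichotomy v j with h | h | h
  · simp [h, h.not_gt, baseMat, siteM]
  · subst h; simp [htq]
  · simp [h, h.not_gt, baseMat, siteM]

lemma contr_mgf (n d : ℕ) (hd : 0 < d) {p lam : ℝ} (v : Fin n) {t q : Fin d}
    (htq : t ≠ q) (a b : Fin n) :
    ∑ s, siteW d p s * Real.exp (lam * contr n d v t q a b s)
      ≤ Real.exp (((if a = v then (if v < b then 1 else 0) else 0) +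
    (if b = v then (if a < v then 1 else 0) else 0)) * ((1 - p) / d * (Real.exp lam - 1))) := by
  unfold contr
  by_cases h1 : a = v ∧ v < b
  · obtain ⟨rfl, h⟩ := h1
    simpa [h, h.ne'] using site_mgf d hd p lam htq
  by_cases h2 : b = v ∧ a < v
  · obtain ⟨rfl, h⟩ := h2
    simpa [h, h.ne] using site_mgf d hd p lam htq.symm
  have e1 : ∀ x : ℝ, (if a = v then (if v < b then x else 0) else 0) = 0 := by
    intro x; rw [← ite_and, if_neg h1]
  have e2 : ∀ x : ℝ, (if b = v then (if a < v then x else 0) else 0) = 0 := by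
    intro x; rw [← ite_and, if_neg h2]
  simp only [e1, e2]
  simp [siteW_sum]

lemma count_mgf (n d : ℕ) (hd : 0 < d) {p lam : ℝ} (hp0 : 0 ≤ p) (hp1 : p ≤ 1) (hl : 0 ≤ lam)
    (v : Fin n) {t q : Fin d} (htq : t ≠ q) :
    ∑ ω, wtJOM n d p ω * Real.exp (lam * ∑ j, XinRand n d ω v j t q)
      ≤ Real.exp (n * ((1 - p) / d * (Real.exp lam - 1))) := by
  have e : ∀ ω : Sample n d, wtJOM n d p ω * Real.exp (lam * ∑ j, XinRand n d ω v j t q)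
      = ∏ a, ∏ b, (siteW d p (ω a b) * Real.exp (lam * contr n d v t q a b (ω a b))) := by
    intro ω
    rw [wt_eq, count_eq n d ω v htq]
    simp_rw [Finset.prod_mul_distrib, Finset.mul_sum, Real.exp_sum]
  simp_rw [e]
  rw [sample_sum_prod n d
    (fun a b s => siteW d p s * Real.exp (lam * contr n d v t q a b s))]
  have hK : 0 ≤ (1 - p) / d * (Real.exp lam - 1) := by
    have := Real.add_one_le_exp lam
    exact mul_nonneg (div_nonneg (by linarith) (by positivity)) (by linarith)
  refine (Finset.prod_le_prod (fun a _ => Finset.prod_nonneg fun b _ =>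
    Finset.sum_nonneg fun s _ => mul_nonneg (siteW_nonneg d hp0 hp1 s) (Real.exp_pos _).le)
    (fun a _ => Finset.prod_le_prod (fun b _ =>
    Finset.sum_nonneg fun s _ => mul_nonneg (siteW_nonneg d hp0 hp1 s) (Real.exp_pos _).le)
    (fun b _ => contr_mgf n d hd v htq a b))).trans ?_
  simp_rw [← Real.exp_sum, ← Finset.sum_mul]
  apply Real.exp_le_exp.2
  apply mul_le_mul_of_nonneg_right _ hK
  simp_rw [Finset.sum_add_distrib]
  rw [Finset.sum_comm (f := fun a b => if a = v then (if v < b then (1 : ℝ) else 0) else 0)]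
  simp only [Finset.sum_ite_eq', Finset.mem_univ, if_true]
  rw [← Finset.sum_add_distrib]
  calc _ ≤ ∑ _j : Fin n, (1 : ℝ) := by
        apply Finset.sum_le_sum; intro j _
        rcases lt_trichotomy v j with h | h | h
        · simp [h, h.not_gt]
        · subst h; simp
        · simp [h, h.not_gt]
    _ = n := by simp

lemma count_tail (n d : ℕ) (hd : 0 < d) {p lam T : ℝ} (hp0 : 0 ≤ p) (hp1 : p ≤ 1) (hl : 0 ≤ lam)
    (v : Fin n) {t q : Fin d} (htq : t ≠ q) :
    prJOM n d p (fun ω => T < ∑ j, XinRand n d ω v j t q)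
      ≤ Real.exp (n * ((1 - p) / d * (Real.exp lam - 1)) - lam * T) := by
  rw [sub_eq_add_neg, Real.exp_add]
  refine le_trans ?_ (mul_le_mul_of_nonneg_right (count_mgf n d hd hp0 hp1 hl v htq)
    (Real.exp_pos _).le)
  unfold prJOM
  rw [Finset.sum_mul]
  apply Finset.sum_le_sum; intro ω _
  have hw := wt_nonneg n d hp0 hp1 ω
  split_ifs with h
  · rw [mul_assoc, ← Real.exp_add]
    apply le_mul_of_one_le_right hw
    apply Real.one_le_exp
    nlinarith
  · positivity

lemma count_tail_main (n d : ℕ) (hd : 0 < d) {p : ℝ} (hp : 0.585 < p) (hp1 : p ≤ 1)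
    (v : Fin n) {t q : Fin d} (htq : t ≠ q) :
    prJOM n d p (fun ω => 0.415 * n / d < ∑ j, XinRand n d ω v j t q)
      ≤ Real.exp (-((p - 0.585) ^ 2 * p) * (n / d)) := by
  have hr : 0 ≤ p - 0.585 := by linarith
  refine (count_tail n d hd (by linarith) hp1 hr v htq).trans (Real.exp_le_exp.2 ?_)
  have he : Real.exp (p - 0.585) - 1 ≤ (p - 0.585) + (p - 0.585) ^ 2 := by
    have := Real.abs_exp_sub_one_sub_id_le (x := p - 0.585) (by rw [abs_of_nonneg hr]; linarith)
    linarith [(abs_le.1 this).2]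
  have hnd : (0 : ℝ) ≤ n / d := by positivity
  have : (n : ℝ) * ((1 - p) / d * (Real.exp (p - 0.585) - 1)) - (p - 0.585) * (0.415 * n / d)
      = (n / d) * ((1 - p) * (Real.exp (p - 0.585) - 1) - (p - 0.585) * 0.415) := by ring
  rw [this, mul_comm (-_)]
  apply mul_le_mul_of_nonneg_left _ hnd
  have := mul_le_mul_of_nonneg_left he (by linarith : 0 ≤ 1 - p)
  nlinarith

lemma prJOM_le_one (n d : ℕ) {p : ℝ} (hp0 : 0 ≤ p) (hp1 : p ≤ 1) (E : Sample n d → Prop) :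
    prJOM n d p E ≤ 1 := by
  rw [← wt_sum n d p]
  unfold prJOM
  apply Finset.sum_le_sum; intro ω _
  split_ifs
  · exact le_rfl
  · exact wt_nonneg n d hp0 hp1 ω

lemma recovery_prob (n d : ℕ) (hd : 2 ≤ d) {p : ℝ} (hp : 0.585 < p) (hp1 : p ≤ 1) :
    1 - n * (d : ℝ) ^ 2 * Real.exp (-((p - 0.585) ^ 2 * p) * (n / d)) ≤
      prJOM n d p (fun ω =>
          lpFeasible n d (fun _ _ => 1) ∧
            ∀ Y : Fin n → Fin n → Matrix (Fin d) (Fin d) ℝ,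
              lpFeasible n d Y →
                (∀ i j : Fin n, i < j → Y i j = 1) ∨
                  lpObj n d (aRand n d ω) (fun _ _ => 1) <
                    lpObj n d (aRand n d ω) Y) := by
  set E : Sample n d → Prop := fun ω =>
          lpFeasible n d (fun _ _ => 1) ∧
            ∀ Y : Fin n → Fin n → Matrix (Fin d) (Fin d) ℝ,
              lpFeasible n d Y →
                (∀ i j : Fin n, i < j → Y i j = 1) ∨
                  lpObj n d (aRand n d ω) (fun _ _ => 1) <
                    lpObj n d (aRand n d ω) Y with hE
  have hp0 : 0 ≤ p := by linarith
  set F : Fin n → Fin d → Fin d → Sample n d → Prop := fun v t q ω =>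
    t ≠ q ∧ 0.415 * n / d < ∑ j, XinRand n d ω v j t q with hF
  have hcover : ∀ ω, ¬ E ω → ∃ v t q, F v t q ω := by
    intro ω hω
    by_contra hcon
    push Not at hcon
    apply hω
    refine ⟨feasible_one n d, fun Y hY => det_recovery hd ω ?_ Y hY⟩
    intro i t q htq
    by_contra hlt
    exact hcon i t q ⟨htq, not_le.1 hlt⟩
  have hFp : ∀ v t q, prJOM n d p (F v t q) ≤ Real.exp (-((p - 0.585) ^ 2 * p) * (n / d)) := by
    intro v t q
    by_cases h : t = q
    · simp only [hF, prJOM, h, ne_eq, not_true_eq_false, false_and, if_false,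
        Finset.sum_const_zero]
      exact (Real.exp_pos _).le
    · simpa [hF, h] using count_tail_main n d (by omega) hp hp1 v h
  clear_value F
  have hunion : 1 ≤ prJOM n d p E + ∑ v, ∑ t, ∑ q, prJOM n d p (F v t q) := by
    rw [← wt_sum n d p]
    have : ∑ v, ∑ t, ∑ q, prJOM n d p (F v t q)
        = ∑ ω, ∑ v, ∑ t, ∑ q, (if F v t q ω then wtJOM n d p ω else 0) := by
      unfold prJOM
      conv_rhs => rw [Finset.sum_comm]
      apply Finset.sum_congr rfl; intro v _
      conv_rhs => rw [Finset.sum_comm]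
      apply Finset.sum_congr rfl; intro t _
      conv_rhs => rw [Finset.sum_comm]
    rw [this]
    unfold prJOM
    rw [← Finset.sum_add_distrib]
    apply Finset.sum_le_sum; intro ω _
    have hw := wt_nonneg n d hp0 hp1 ω
    have h0 : ∀ v t q, 0 ≤ (if F v t q ω then wtJOM n d p ω else 0) := by
      intro v t q; split_ifs <;> simp [hw]
    by_cases hEω : E ω
    · rw [if_pos hEω]
      have : 0 ≤ ∑ v, ∑ t, ∑ q, (if F v t q ω then wtJOM n d p ω else 0) :=
        Finset.sum_nonneg fun v _ => Finset.sum_nonneg fun t _ => Finset.sum_nonneg fun q _ =>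
          h0 v t q
      linarith
    · rw [if_neg hEω, zero_add]
      obtain ⟨v, t, q, h⟩ := hcover ω hEω
      calc wtJOM n d p ω = (if F v t q ω then wtJOM n d p ω else 0) := by rw [if_pos h]
        _ ≤ ∑ q, (if F v t q ω then wtJOM n d p ω else 0) :=
          Finset.single_le_sum (f := fun q => (if F v t q ω then wtJOM n d p ω else 0))
            (fun q _ => h0 v t q) (Finset.mem_univ q)
        _ ≤ ∑ t, ∑ q, (if F v t q ω then wtJOM n d p ω else 0) :=
          Finset.single_le_sum (f := fun t => ∑ q, (if F v t q ω then wtJOM n d p ω else 0))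
            (fun t _ => Finset.sum_nonneg fun q _ => h0 v t q) (Finset.mem_univ t)
        _ ≤ _ :=
          Finset.single_le_sum
            (f := fun v => ∑ t, ∑ q, (if F v t q ω then wtJOM n d p ω else 0))
            (fun v _ => Finset.sum_nonneg fun t _ => Finset.sum_nonneg fun q _ => h0 v t q)
            (Finset.mem_univ v)
  have hsum : ∑ v, ∑ t, ∑ q, prJOM n d p (F v t q)
      ≤ n * (d : ℝ) ^ 2 * Real.exp (-((p - 0.585) ^ 2 * p) * (n / d)) := by
    calc _ ≤ ∑ _v : Fin n, ∑ _t : Fin d, ∑ _q : Fin d,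
          Real.exp (-((p - 0.585) ^ 2 * p) * (n / d)) :=
        Finset.sum_le_sum fun v _ => Finset.sum_le_sum fun t _ => Finset.sum_le_sum fun q _ =>
          hFp v t q
      _ = _ := by
        simp only [Finset.sum_const, Finset.card_univ, Fintype.card_fin, nsmul_eq_mul]; ring
  linarith

lemma tail_lim (η : ℝ) (hη : 0 < η) :
    Filter.Tendsto (fun n : ℕ => (n : ℝ) ^ 2 * Real.exp (-η * Real.sqrt n)) Filter.atTop
      (nhds 0) := by
  have h1 := Real.tendsto_pow_mul_exp_neg_atTop_nhds_zero 4
  have h2 : Filter.Tendsto (fun n : ℕ => η * Real.sqrt n) Filter.atTop Filter.atTop :=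
    Filter.Tendsto.const_mul_atTop hη
      (Real.tendsto_sqrt_atTop.comp tendsto_natCast_atTop_atTop)
  have h3 := (h1.comp h2).const_mul (1 / η ^ 4)
  rw [mul_zero] at h3
  refine h3.congr fun n => ?_
  have : Real.sqrt n ^ 4 = (n : ℝ) ^ 2 := by
    rw [show (4 : ℕ) = 2 * 2 by norm_num, pow_mul, Real.sq_sqrt (Nat.cast_nonneg n)]
  simp only [Function.comp, mul_pow, this]
  field_simp

/-- Main recovery theorem: under the random corruption model, if
`d(n)⁴ log n / n → 0` and `p_true > 0.585`, then with probability tending to one the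
ground truth (all identity matrices) is the unique optimal solution of the basic
LP (P). -/
theorem basic_LP_recovery_whp
    (d : ℕ → ℕ) (hd : ∀ n, 2 ≤ d n)
    (hdo : Filter.Tendsto (fun n : ℕ => (d n : ℝ) ^ 4 * Real.log n / n)
      Filter.atTop (nhds 0))
    (p : ℝ) (hp : 0.585 < p) (hp1 : p ≤ 1) :
    Filter.Tendsto (fun n : ℕ =>
        prJOM n (d n) p (fun ω =>
          lpFeasible n (d n) (fun _ _ => 1) ∧
            ∀ Y : Fin n → Fin n → Matrix (Fin (d n)) (Fin (d n)) ℝ,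
              lpFeasible n (d n) Y →
                (∀ i j : Fin n, i < j → Y i j = 1) ∨
                  lpObj n (d n) (aRand n (d n) ω) (fun _ _ => 1) <
                    lpObj n (d n) (aRand n (d n) ω) Y))
      Filter.atTop (nhds 1) := by
  have hp0 : 0 ≤ p := by linarith
  have hη : 0 < (p - 0.585) ^ 2 * p := mul_pos (pow_pos (by linarith) 2) (by linarith)
  have hlow := (tail_lim _ hη).const_sub 1
  rw [sub_zero] at hlow
  refine tendsto_of_tendsto_of_tendsto_of_le_of_le' hlow tendsto_const_nhds ?_
    (Filter.Eventually.of_forall fun n => prJOM_le_one n (d n) hp0 hp1 _)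
  filter_upwards [hdo.eventually (gt_mem_nhds (zero_lt_one)), Filter.eventually_ge_atTop 3]
    with n hn hn3
  refine le_trans ?_ (recovery_prob n (d n) (hd n) hp hp1)
  have hnR : (3 : ℝ) ≤ n := by exact_mod_cast hn3
  have hlog : 1 ≤ Real.log n := by
    rw [Real.le_log_iff_exp_le (by linarith)]
    linarith [Real.exp_one_lt_d9]
  have hd1 : (2 : ℝ) ≤ d n := by exact_mod_cast hd n
  have hd4 : (d n : ℝ) ^ 4 ≤ n := by
    rw [div_lt_one (by linarith)] at hn
    have : (0 : ℝ) ≤ (d n : ℝ) ^ 4 := by positivity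
    nlinarith
  have hd2s : (d n : ℝ) ^ 2 ≤ Real.sqrt n := by
    apply Real.le_sqrt_of_sq_le
    rw [← pow_mul]; exact hd4
  have hds : (d n : ℝ) ≤ Real.sqrt n := by nlinarith
  have hd2 : (d n : ℝ) ^ 2 ≤ n := by nlinarith [sq_nonneg ((d n : ℝ) ^ 2 - 1)]
  have hnd : Real.sqrt n ≤ n / d n := by
    rw [le_div_iff₀ (by linarith)]
    calc Real.sqrt n * d n ≤ Real.sqrt n * Real.sqrt n :=
          mul_le_mul_of_nonneg_left hds (Real.sqrt_nonneg _)
      _ = n := Real.mul_self_sqrt (by linarith)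
  have hexp : Real.exp (-((p - 0.585) ^ 2 * p) * (n / d n))
      ≤ Real.exp (-((p - 0.585) ^ 2 * p) * Real.sqrt n) := by
    apply Real.exp_le_exp.2
    nlinarith
  have : (n : ℝ) * (d n : ℝ) ^ 2 * Real.exp (-((p - 0.585) ^ 2 * p) * (n / d n))
      ≤ (n : ℝ) ^ 2 * Real.exp (-((p - 0.585) ^ 2 * p) * Real.sqrt n) := by
    apply mul_le_mul _ hexp (Real.exp_pos _).le (by positivity)
    nlinarith
  linarith

end
end

section
/- Let α > 0, β > 0 and p ∈ [α/2, 1]. Then for every real d ≥ 2, ε₃(d) := 2(p + (1−p)/d)(p/(βd) − ((1−p)/d)(1/α − 1/(βd)) + 1/α) − 1 > 0. Moreover, ε₃ is strictly decreasing in d on [2, ∞) with limit 2p/α − 1 ≥ 0 as d → ∞. -/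
/-- `ε₃` as a function of `x = 1/d`. -/
noncomputable def epsAux (α β p x : ℝ) : ℝ :=
  2 * α⁻¹ * ((p + (1 - p) * x) * (1 - (1 - p) * x))
    + 2 * β⁻¹ * (x * (p + (1 - p) * x) ^ 2) - 1

lemma epsAux_eq (α β p d : ℝ) :
    2 * (p + (1 - p) / d) *
      (p / (β * d) - ((1 - p) / d) * (1 / α - 1 / (β * d)) + 1 / α) - 1
      = epsAux α β p d⁻¹ := by
  simp only [epsAux, div_eq_mul_inv, mul_inv]
  ring

lemma epsAux_lt (α β p x y : ℝ) (hα : 0 < α) (hβ : 0 < β) (hp : 0 < p) (hp1 : p ≤ 1)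
    (hx : 0 ≤ x) (hxy : x < y) (hy : y ≤ 1 / 2) : epsAux α β p x < epsAux α β p y := by
  have ha : 0 < α⁻¹ := inv_pos.mpr hα
  have hb : 0 < β⁻¹ := inv_pos.mpr hβ
  have hq : 0 ≤ 1 - p := by linarith
  have h1 : (p + (1 - p) * x) * (1 - (1 - p) * x)
      ≤ (p + (1 - p) * y) * (1 - (1 - p) * y) := by
    have h : 0 ≤ (y - x) * (1 - p) ^ 2 * (1 - x - y) :=
      mul_nonneg (mul_nonneg (by linarith) (sq_nonneg _)) (by linarith)
    nlinarith [h]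
  have h2 : x * (p + (1 - p) * x) ^ 2 < y * (p + (1 - p) * y) ^ 2 := by
    have h0 : 0 < p + (1 - p) * x := by positivity
    have h3 : p + (1 - p) * x ≤ p + (1 - p) * y := by gcongr
    have h4 : (p + (1 - p) * x) ^ 2 ≤ (p + (1 - p) * y) ^ 2 := by gcongr
    calc x * (p + (1 - p) * x) ^ 2 < y * (p + (1 - p) * x) ^ 2 := by gcongr
      _ ≤ y * (p + (1 - p) * y) ^ 2 := mul_le_mul_of_nonneg_left h4 (by linarith)
  have h5 := mul_le_mul_of_nonneg_left h1 (by positivity : 0 ≤ 2 * α⁻¹)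
  have h6 := mul_lt_mul_of_pos_left h2 (by positivity : 0 < 2 * β⁻¹)
  unfold epsAux
  linarith

/-- If `α/2 ≤ p ≤ 1`, then `ε₃(d) = 2(p + (1−p)/d)(p/(βd) − ((1−p)/d)(1/α − 1/(βd)) + 1/α) − 1`
is strictly positive for every real `d ≥ 2`; moreover `ε₃` is strictly decreasing on
`[2, ∞)` with limit `2p/α − 1 ≥ 0` as `d → ∞`. -/
theorem eps3_positive_decreasing_limit
    (α β p : ℝ) (hα : 0 < α) (hβ : 0 < β) (hp : α / 2 ≤ p) (hp1 : p ≤ 1) :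
    (∀ d : ℝ, 2 ≤ d →
        0 < 2 * (p + (1 - p) / d) *
              (p / (β * d) - ((1 - p) / d) * (1 / α - 1 / (β * d)) + 1 / α) - 1) ∧
    StrictAntiOn
      (fun d : ℝ => 2 * (p + (1 - p) / d) *
          (p / (β * d) - ((1 - p) / d) * (1 / α - 1 / (β * d)) + 1 / α) - 1)
      (Set.Ici (2 : ℝ)) ∧
    Filter.Tendsto
      (fun d : ℝ => 2 * (p + (1 - p) / d) *
          (p / (β * d) - ((1 - p) / d) * (1 / α - 1 / (β * d)) + 1 / α) - 1)
      Filter.atTop (nhds (2 * p / α - 1)) ∧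
    0 ≤ 2 * p / α - 1 := by
  have hp0 : 0 < p := by linarith
  have h0 : epsAux α β p 0 = 2 * p / α - 1 := by
    simp only [epsAux, div_eq_mul_inv]; ring
  have hn : 0 ≤ 2 * p / α - 1 := by
    rw [sub_nonneg, le_div_iff₀ hα]; linarith
  have hinv : ∀ d : ℝ, 2 ≤ d → d⁻¹ ≤ 1 / 2 := fun d hd => by
    rw [one_div]; exact inv_anti₀ (by norm_num) hd
  simp only [epsAux_eq]
  refine ⟨fun d hd => ?_, fun c hc d hd hcd => ?_, ?_, hn⟩
  · have hpos : 0 < d⁻¹ := inv_pos.mpr (by linarith)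
    have := epsAux_lt α β p 0 d⁻¹ hα hβ hp0 hp1 le_rfl hpos (hinv d hd)
    linarith
  · have hc' : (2 : ℝ) ≤ c := hc
    have hd' : (2 : ℝ) ≤ d := hd
    exact epsAux_lt α β p d⁻¹ c⁻¹ hα hβ hp0 hp1 (inv_nonneg.mpr (by linarith))
      (inv_strictAnti₀ (by linarith) hcd) (hinv c hc')
  · rw [← h0]
    have hcont : Continuous (epsAux α β p) := by
      unfold epsAux; fun_prop
    exact (hcont.tendsto 0).comp tendsto_inv_atTop_zero
end
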